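/- For every complex number s with Re(s) > 1, the sum over isomorphism classes of quadratic fields K of |Disc(K)|^{-s} converges and equals −1 + (1 − 2^{-s} + 2·4^{-s})·ζ(s)/ζ(2s). -/

import Mathlib

/-- A quadratic field: a number field of degree 2 over `ℚ`. -/
structure QuadraticField where
  carrier : Type
  [field : Field carrier]
  [nf : NumberField carrier]
  deg : Module.finrank ℚ carrier = 2

attribute [instance] QuadraticField.field QuadraticField.nf

/-- Two quadratic fields are identified if they are isomorphic. -/
instance QuadraticField.setoid : Setoid QuadraticField where
  r A B := Nonempty (A.carrier ≃+* B.carrier)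
  iseqv := ⟨fun _ => ⟨RingEquiv.refl _⟩, fun ⟨e⟩ => ⟨e.symm⟩, fun ⟨e⟩ ⟨f⟩ => ⟨e.trans f⟩⟩

section

open QuadraticAlgebra NumberField

theorem discr_quadraticAlgebra_basis (A B : ℤ) :
    Algebra.discr ℤ (QuadraticAlgebra.basis A B) = B ^ 2 + 4 * A := by
  rw [Algebra.discr_def, Matrix.det_fin_two]
  simp only [Algebra.traceMatrix_apply, Algebra.traceForm_apply,
    Algebra.trace_eq_matrix_trace (QuadraticAlgebra.basis A B), Matrix.trace_fin_two,
    Algebra.leftMulMatrix_eq_repr_mul]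
  simp [QuadraticAlgebra.basis]
  ring

theorem eq_one_of_squarefree_of_isSquare {d : ℤ} (hd : Squarefree d) (h : IsSquare d) : d = 1 := by
  obtain ⟨r, rfl⟩ := h
  have := hd r dvd_rfl
  rcases Int.isUnit_iff.1 this with rfl | rfl <;> simp

theorem rat_sq_ne_of_squarefree {d : ℤ} (hd : Squarefree d) (h1 : d ≠ 1) (r : ℚ) :
    r ^ 2 ≠ d := by
  intro h
  exact h1 (eq_one_of_squarefree_of_isSquare hd (Rat.isSquare_intCast_iff.1 ⟨r, by rw [← h, sq]⟩))

theorem exists_int_eq_of_squarefree_mul_sq {d n : ℤ} (hd : Squarefree d) {r : ℚ}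
    (h : (d : ℚ) * r ^ 2 = n) : ∃ m : ℤ, r = m := by
  have hq : (r.den : ℚ) ≠ 0 := by exact_mod_cast r.den_nz
  have key : d * r.num ^ 2 = n * (r.den : ℤ) ^ 2 := by
    rw [← Rat.num_div_den r, div_pow, ← mul_div_assoc, div_eq_iff (pow_ne_zero _ hq)] at h
    exact_mod_cast h
  have hc : IsCoprime r.num (r.den : ℤ) := Rat.isCoprime_num_den r
  have h1 : IsUnit (r.den : ℤ) := hd _ (by
    rw [← sq]
    exact (hc.symm.pow (m := 2) (n := 2)).dvd_of_dvd_mul_right ⟨n, by rw [key]; ring⟩)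
  have h2 : r.den = 1 := by simpa using Int.isUnit_iff_natAbs_eq.1 h1
  exact ⟨r.num, ((Rat.den_eq_one_iff r).1 h2).symm⟩

theorem squarefree_eq_of_mul_rat_sq {d d' : ℤ} (hd : Squarefree d) (hd' : Squarefree d') (r : ℚ)
    (h : (d' : ℚ) * r ^ 2 = d) : d' = d := by
  obtain ⟨m, rfl⟩ := exists_int_eq_of_squarefree_mul_sq hd' h
  have key : d' * m ^ 2 = d := by exact_mod_cast h
  rcases Int.isUnit_iff.1 (hd m ⟨d', by rw [← key]; ring⟩) with h | h <;> simpa [h] using key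

/-- The parameters of quadratic fields: squarefree integers other than `1`. -/
abbrev QuadParam := {d : ℤ // Squarefree d ∧ d ≠ 1}

instance (d : QuadParam) : Fact (∀ r : ℚ, r ^ 2 ≠ ((d : ℤ) : ℚ) + 0 * r) :=
  ⟨fun r => by simpa using rat_sq_ne_of_squarefree d.2.1 d.2.2 r⟩

/-- The field `ℚ(√d)`. -/
abbrev QSqrt (d : QuadParam) := QuadraticAlgebra ℚ ((d : ℤ) : ℚ) 0

instance (d : QuadParam) : NumberField (QSqrt d) where
  to_finiteDimensional := by
    convert! (inferInstance : Module.Finite ℚ (QSqrt d))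

theorem finrank_qSqrt (d : QuadParam) : Module.finrank ℚ (QSqrt d) = 2 :=
  QuadraticAlgebra.finrank_eq_two _ _

theorem discr_eq_of_quadratic_generator {K : Type*} [Field K] [NumberField K] {A B : ℤ}
    (t : K) (ht : t * t = A + B * t)
    (hspan : ∀ x : K, IsIntegral ℤ x → ∃ m n : ℤ, (m + n * t : K) = x)
    (hinj : ∀ m n : ℤ, (m + n * t : K) = 0 → m = 0 ∧ n = 0) :
    discr K = B ^ 2 + 4 * A := by
  have hti : IsIntegral ℤ t := by
    refine ⟨Polynomial.X ^ 2 - (Polynomial.C B * Polynomial.X + Polynomial.C A), ?_, ?_⟩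
    · monicity!
    · rw [Polynomial.eval₂_sub, Polynomial.eval₂_add, Polynomial.eval₂_mul, Polynomial.eval₂_pow,
        Polynomial.eval₂_X, Polynomial.eval₂_C, Polynomial.eval₂_C, sq, ht]
      simp [add_comm]
  let θ : 𝓞 K := ⟨t, hti⟩
  have hcoe : ∀ m n : ℤ, algebraMap (𝓞 K) K (m • 1 + n • θ) = m + n * t := fun m n => by
    rw [map_add, map_zsmul, map_zsmul, map_one, zsmul_eq_mul, zsmul_eq_mul, mul_one]
    rfl
  have hθ : θ * θ = A • 1 + B • θ := by
    apply FaithfulSMul.algebraMap_injective (𝓞 K) K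
    rw [hcoe, map_mul, ← ht]
    rfl
  let φ : QuadraticAlgebra ℤ A B →ₐ[ℤ] 𝓞 K := QuadraticAlgebra.lift ⟨θ, hθ⟩
  have hφ : ∀ z, φ z = z.re • 1 + z.im • θ := fun z => rfl
  have hb : Function.Bijective φ := by
    refine ⟨(injective_iff_map_eq_zero φ).2 fun z hz => ?_, fun x => ?_⟩
    · obtain ⟨h1, h2⟩ := hinj z.re z.im (by rw [← hcoe, ← hφ, hz, map_zero])
      ext <;> simp [h1, h2]
    · obtain ⟨m, n, h⟩ := hspan x x.2
      refine ⟨⟨m, n⟩, ?_⟩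
      apply FaithfulSMul.algebraMap_injective (𝓞 K) K
      rw [hφ, hcoe, h]
  let e := AlgEquiv.ofBijective φ hb
  rw [← discr_quadraticAlgebra_basis A B, ← NumberField.discr_eq_discr K
    ((QuadraticAlgebra.basis A B).map e.toLinearEquiv),
    Algebra.discr_eq_discr_of_algEquiv _ e]
  rfl

theorem int_of_isIntegral_rat_qSqrt {d : QuadParam} {q : ℚ}
    (h : IsIntegral ℤ (⟨q, 0⟩ : QSqrt d)) : ∃ n : ℤ, q = n := by
  have h' : IsIntegral ℤ (algebraMap ℚ (QSqrt d) q) := h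
  rw [isIntegral_algebraMap_iff (algebraMap ℚ (QSqrt d)).injective] at h'
  obtain ⟨n, hn⟩ := IsIntegrallyClosed.isIntegral_iff.1 h'
  exact ⟨n, by simpa using hn.symm⟩

theorem exists_int_of_isIntegral_qSqrt {d : QuadParam} {x : QSqrt d} (hx : IsIntegral ℤ x) :
    ∃ u v : ℤ, 2 * x.re = u ∧ 2 * x.im = v ∧ (4 : ℤ) ∣ u ^ 2 - d * v ^ 2 := by
  have hs : IsIntegral ℤ (star x) := hx.map (starRingEnd (QSqrt d)).toIntAlgHom
  obtain ⟨u, hu⟩ : ∃ n : ℤ, 2 * x.re = n := by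
    refine int_of_isIntegral_rat_qSqrt (d := d) ?_
    have h : x + star x = ⟨2 * x.re, 0⟩ := by
      ext <;> simp
      ring
    exact h ▸ hx.add hs
  obtain ⟨N, hN⟩ : ∃ n : ℤ, x.re ^ 2 - d * x.im ^ 2 = n := by
    refine int_of_isIntegral_rat_qSqrt (d := d) ?_
    have h : x * star x = ⟨x.re ^ 2 - d * x.im ^ 2, 0⟩ := by
      ext <;> simp <;> ring
    exact h ▸ hx.mul hs
  have hv : ((d : ℤ) : ℚ) * (2 * x.im) ^ 2 = ((u ^ 2 - 4 * N : ℤ) : ℚ) := by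
    push_cast
    rw [← hu, ← hN]
    ring
  obtain ⟨v, hv'⟩ := exists_int_eq_of_squarefree_mul_sq d.2.1 hv
  refine ⟨u, v, hu, hv', N, ?_⟩
  rw [hv'] at hv
  have : (d : ℤ) * v ^ 2 = u ^ 2 - 4 * N := by exact_mod_cast hv
  linarith

theorem int_sq_emod_four (u : ℤ) : (u % 2 = 0 ∧ u ^ 2 % 4 = 0) ∨ (u % 2 = 1 ∧ u ^ 2 % 4 = 1) := by
  rcases Int.even_or_odd' u with ⟨k, rfl | rfl⟩
  · left; ring_nf; omega
  · right; ring_nf; omega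

theorem four_not_dvd_of_squarefree {d : ℤ} (hd : Squarefree d) : ¬ (4 : ℤ) ∣ d := by
  intro h
  have := hd 2 (by simpa using h)
  simp [Int.isUnit_iff] at this

/-- The discriminant of `ℚ(√d)`. -/
def fundDisc (d : ℤ) : ℤ := if d % 4 = 1 then d else 4 * d

theorem discr_qSqrt (d : QuadParam) : discr (QSqrt d) = fundDisc d := by
  have h4 := four_not_dvd_of_squarefree d.2.1
  unfold fundDisc
  split_ifs with h
  · obtain ⟨k, hk⟩ : ∃ k, (d : ℤ) = 4 * k + 1 := ⟨d / 4, by omega⟩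
    have hkQ : ((d : ℤ) : ℚ) = 4 * k + 1 := by exact_mod_cast hk
    have := discr_eq_of_quadratic_generator (K := QSqrt d) (A := k) (B := 1) ⟨1 / 2, 1 / 2⟩
      (by ext <;> simp [hkQ] <;> ring) ?_ ?_
    · rw [this, hk]; ring
    · intro x hx
      obtain ⟨u, v, hu, hv, h⟩ := exists_int_of_isIntegral_qSqrt hx
      obtain ⟨m, hm⟩ : ∃ m, u = 2 * m + v := by
        refine ⟨(u - v) / 2, ?_⟩
        have := int_sq_emod_four u
        have := int_sq_emod_four v
        rw [hk, show u ^ 2 - (4 * k + 1) * v ^ 2 = u ^ 2 - v ^ 2 - 4 * (k * v ^ 2) by ring] at h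
        generalize k * v ^ 2 = w at *
        omega
      refine ⟨m, v, ?_⟩
      have hmQ : (u : ℚ) = 2 * m + v := by exact_mod_cast hm
      ext <;> simp <;> linarith
    · intro m n h
      have h1 := congrArg QuadraticAlgebra.re h
      have h2 := congrArg QuadraticAlgebra.im h
      simp at h1 h2
      subst h2
      simpa using h1
  · have := discr_eq_of_quadratic_generator (K := QSqrt d) (A := d) (B := 0) ω
      (by ext <;> simp) ?_ ?_
    · rw [this]; ring
    · intro x hx
      obtain ⟨u, v, hu, hv, h⟩ := exists_int_of_isIntegral_qSqrt hx
      obtain ⟨m, n, hm, hn⟩ : ∃ m n, u = 2 * m ∧ v = 2 * n := by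
        refine ⟨u / 2, v / 2, ?_⟩
        have := int_sq_emod_four u
        rcases int_sq_emod_four v with hv | hv
        · obtain ⟨w, hw⟩ : (4 : ℤ) ∣ v ^ 2 := Int.dvd_of_emod_eq_zero hv.2
          rw [hw, mul_left_comm] at h
          generalize (d : ℤ) * w = w at *
          omega
        · obtain ⟨w, hw⟩ : ∃ w, v ^ 2 = 4 * w + 1 := ⟨v ^ 2 / 4, by omega⟩
          rw [hw, show (d : ℤ) * (4 * w + 1) = 4 * (d * w) + d by ring] at h
          generalize (d : ℤ) * w = w at *
          omega
      refine ⟨m, n, ?_⟩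
      have hmQ : (u : ℚ) = 2 * m := by exact_mod_cast hm
      have hnQ : (v : ℚ) = 2 * n := by exact_mod_cast hn
      ext <;> simp <;> linarith
    · intro m n h
      have h1 := congrArg QuadraticAlgebra.re h
      have h2 := congrArg QuadraticAlgebra.im h
      simp at h1 h2
      exact ⟨h1, h2⟩

theorem qSqrt_ringEquiv_eq {d d' : QuadParam} (e : QSqrt d ≃+* QSqrt d') : d = d' := by
  set x : QSqrt d' := e ω with hx
  have hxx : x * x = ((d : ℤ) : QSqrt d') := by
    rw [hx, ← map_mul, ← map_intCast e]
    congr 1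
    ext <;> simp
  have h1 := congrArg QuadraticAlgebra.re hxx
  have h2 := congrArg QuadraticAlgebra.im hxx
  simp at h1 h2
  have h2 : x.re = 0 ∨ x.im = 0 := by
    rw [← mul_eq_zero]; linarith
  rcases h2 with h2 | h2
  · exact Subtype.ext (squarefree_eq_of_mul_rat_sq d.2.1 d'.2.1 x.im (by rw [← h1, h2]; ring)).symm
  · exact absurd (by rw [← h1, h2]; ring) (rat_sq_ne_of_squarefree d.2.1 d.2.2 x.re)

theorem exists_sq_eq_rat {K : Type*} [Field K] [NumberField K] (h2 : Module.finrank ℚ K = 2) :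
    ∃ (y : K) (q : ℚ), y ^ 2 = q ∧ ∀ r : ℚ, y ≠ r := by
  obtain ⟨x, hx⟩ : ∃ x : K, ∀ r : ℚ, x ≠ r := by
    by_contra! hcon
    have hle : (⊤ : Submodule ℚ K) ≤ Submodule.span ℚ {1} := fun x _ => by
      obtain ⟨r, hr⟩ := hcon x
      exact Submodule.mem_span_singleton.2 ⟨r, by rw [hr, Rat.smul_def, mul_one]⟩
    have h3 := finrank_span_singleton (K := ℚ) (one_ne_zero (α := K))
    rw [top_le_iff.1 hle, finrank_top] at h3
    omega
  have hli : LinearIndependent ℚ ![1, x] := by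
    refine (LinearIndependent.pair_iff' one_ne_zero).2 fun a ha => hx a ?_
    rw [← ha, Rat.smul_def, mul_one]
  have hspan : Submodule.span ℚ (Set.range ![1, x]) = ⊤ :=
    hli.span_eq_top_of_card_eq_finrank (by simp [h2])
  have hxx : x ^ 2 ∈ Submodule.span ℚ (Set.range ![1, x]) := hspan ▸ Submodule.mem_top
  rw [Matrix.range_cons, Matrix.range_cons, Matrix.range_empty, Set.union_empty,
    Set.singleton_union, Submodule.mem_span_pair] at hxx
  obtain ⟨a, b, hab⟩ := hxx
  rw [Rat.smul_def, Rat.smul_def, mul_one] at hab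
  refine ⟨x - ((b / 2 : ℚ) : K), a + b ^ 2 / 4, ?_, fun r hr => hx (r + b / 2) ?_⟩
  · push_cast
    linear_combination -hab
  · push_cast
    push_cast at hr
    linear_combination hr

theorem exists_int_sq_mul_squarefree {N : ℤ} (hN : N ≠ 0) :
    ∃ c d : ℤ, c ≠ 0 ∧ Squarefree d ∧ N = c ^ 2 * d := by
  obtain ⟨a, b, ha, hb, hab, hsq⟩ := Nat.sq_mul_squarefree_of_pos (Int.natAbs_pos.2 hN)
  rcases Int.natAbs_eq N with h | h
  · exact ⟨b, a, by exact_mod_cast hb.ne', Int.squarefree_natCast.2 hsq,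
      by rw [h, ← hab]; push_cast; ring⟩
  · refine ⟨b, -a, by exact_mod_cast hb.ne', ?_, by rw [h, ← hab]; push_cast; ring⟩
    rw [← Int.squarefree_natAbs]
    simpa using hsq

theorem exists_qSqrt_ringEquiv {K : Type*} [Field K] [NumberField K]
    (h2 : Module.finrank ℚ K = 2) : ∃ d : QuadParam, Nonempty (QSqrt d ≃+* K) := by
  obtain ⟨y, q, hy, hr⟩ := exists_sq_eq_rat h2
  have hqd : (q.den : K) ≠ 0 := by exact_mod_cast q.den_nz
  have hy0 : y ≠ 0 := by simpa using hr 0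
  have hq0 : q ≠ 0 := by
    rintro rfl
    exact hy0 (by simpa using hy)
  have hN : q.num * q.den ≠ 0 := mul_ne_zero (Rat.num_ne_zero.2 hq0) (by exact_mod_cast q.den_nz)
  obtain ⟨c, d, hc, hd, hcd⟩ := exists_int_sq_mul_squarefree hN
  have hcK : (c : K) ≠ 0 := by exact_mod_cast hc
  set z : K := q.den * y / c with hz
  have hzz : z ^ 2 = d := by
    have h3 : ((q.num * q.den : ℤ) : K) = c ^ 2 * d := by rw [hcd]; push_cast; ring
    push_cast at h3
    rw [hz, div_pow, mul_pow, hy, div_eq_iff (pow_ne_zero _ hcK), Rat.cast_def, mul_comm (d : K),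
      ← h3]
    field_simp
  have hzr : ∀ r : ℚ, z ≠ r := fun r h => hr (r * c / q.den) (by
    push_cast
    rw [← h, hz]
    field_simp)
  have hd1 : d ≠ 1 := by
    rintro rfl
    rcases (sq_eq_sq_iff_eq_or_eq_neg (b := (1 : K))).1 (by simpa using hzz) with h | h
    · exact hzr 1 (by simpa using h)
    · exact hzr (-1) (by simpa using h)
  refine ⟨⟨d, hd, hd1⟩, ?_⟩
  let φ : QSqrt ⟨d, hd, hd1⟩ →ₐ[ℚ] K := QuadraticAlgebra.lift ⟨z, by
    rw [← sq, hzz, zero_smul, add_zero, Rat.smul_def, mul_one, Rat.cast_intCast]⟩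
  have hinj : Function.Injective φ := φ.toRingHom.injective
  have hsurj : Function.Surjective φ :=
    (LinearMap.injective_iff_surjective_of_finrank_eq_finrank
      (f := φ.toLinearMap) (by rw [h2, QuadraticAlgebra.finrank_eq_two])).1 hinj
  exact ⟨RingEquiv.ofBijective φ ⟨hinj, hsurj⟩⟩

end

theorem sq_mul_squarefree_inj {a b a' b' : ℕ} (ha : Squarefree a) (ha' : Squarefree a')
    (hb' : b' ≠ 0) (h : b ^ 2 * a = b' ^ 2 * a') : a = a' ∧ b = b' := by
  have hbQ : (b' : ℚ) ≠ 0 := by exact_mod_cast hb'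
  have h1 : (a : ℤ) = a' := by
    refine squarefree_eq_of_mul_rat_sq (Int.squarefree_natCast.2 ha') (Int.squarefree_natCast.2 ha)
      (b / b') ?_
    have hQ : (b : ℚ) ^ 2 * a = b' ^ 2 * a' := by exact_mod_cast h
    push_cast
    rw [div_pow, ← mul_div_assoc, div_eq_iff (pow_ne_zero _ hbQ)]
    linear_combination hQ
  have h1 : a = a' := by exact_mod_cast h1
  subst h1
  refine ⟨rfl, ?_⟩
  have := Nat.eq_of_mul_eq_mul_right (Nat.pos_of_ne_zero ha.ne_zero) h
  exact Nat.pow_left_injective two_ne_zero this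

section

variable {s : ℂ}

theorem natCast_mul_cpow_neg (m n : ℕ) :
    ((m * n : ℕ) : ℂ) ^ (-s) = (m : ℂ) ^ (-s) * (n : ℂ) ^ (-s) := by
  rw [Nat.cast_mul, Complex.natCast_mul_natCast_cpow]

theorem summable_natCast_cpow_neg (hs : 1 < s.re) : Summable fun n : ℕ => (n : ℂ) ^ (-s) := by
  simpa [Complex.cpow_neg, one_div] using Complex.summable_one_div_nat_cpow.2 hs

theorem hasSum_natCast_cpow_neg (hs : 1 < s.re) :
    HasSum (fun n : ℕ => (n : ℂ) ^ (-s)) (riemannZeta s) := by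
  have h := (summable_natCast_cpow_neg hs).hasSum
  rw [zeta_eq_tsum_one_div_nat_cpow hs]
  simpa [Complex.cpow_neg, one_div] using h

theorem natCast_cpow_neg_ne_zero_iff (hs : 1 < s.re) (n : ℕ) : (n : ℂ) ^ (-s) ≠ 0 ↔ n ≠ 0 := by
  have : s ≠ 0 := by rintro rfl; norm_num at hs
  simp [Complex.cpow_eq_zero_iff, this]

open Classical in
theorem hasSum_squarefree_cpow_neg (hs : 1 < s.re) :
    HasSum (fun n : ℕ => if Squarefree n then (n : ℂ) ^ (-s) else 0)
      (riemannZeta s / riemannZeta (2 * s)) := by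
  have hs2 : 1 < (2 * s).re := by simp; linarith
  set q : ℕ → ℂ := fun n => if Squarefree n then (n : ℂ) ^ (-s) else 0 with hq
  have hqs : Summable q :=
    Summable.of_norm_bounded (summable_natCast_cpow_neg hs).norm fun n => by
      simp only [hq]
      split_ifs <;> simp
  have hmul := tsum_mul_tsum_of_summable_norm hqs.norm (summable_natCast_cpow_neg hs2).norm
  have hsupp : ∀ x : ℕ × ℕ, q x.1 * (x.2 : ℂ) ^ (-(2 * s)) ≠ 0 ↔ Squarefree x.1 ∧ x.2 ≠ 0 := by
    intro x
    rw [mul_ne_zero_iff, natCast_cpow_neg_ne_zero_iff hs2]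
    refine and_congr_left fun _ => ?_
    by_cases h : Squarefree x.1
    · simpa only [hq, h, if_true, natCast_cpow_neg_ne_zero_iff hs, iff_true] using h.ne_zero
    · simp [hq, h]
  have hz : ∑' x : ℕ × ℕ, q x.1 * (x.2 : ℂ) ^ (-(2 * s)) = ∑' n : ℕ, (n : ℂ) ^ (-s) := by
    symm
    refine tsum_eq_tsum_of_ne_zero_bij (fun x => x.1.2 ^ 2 * x.1.1) ?_ ?_ ?_
    · rintro ⟨⟨a, b⟩, h⟩ ⟨⟨a', b'⟩, h'⟩ hab
      rw [Function.mem_support, hsupp] at h h'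
      obtain ⟨rfl, rfl⟩ := sq_mul_squarefree_inj h.1 h'.1 h'.2 hab
      rfl
    · intro n hn
      rw [Function.mem_support, natCast_cpow_neg_ne_zero_iff hs] at hn
      obtain ⟨a, b, ha, hb, hab, hsq⟩ := Nat.sq_mul_squarefree_of_pos (Nat.pos_of_ne_zero hn)
      exact ⟨⟨(a, b), (hsupp _).2 ⟨hsq, hb.ne'⟩⟩, hab⟩
    · rintro ⟨⟨a, b⟩, h⟩
      have h := (hsupp _).1 (Function.mem_support.1 h)
      simp only [hq, h.1, if_true]
      have hb : (b : ℂ) ≠ 0 := by exact_mod_cast h.2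
      rw [sq, natCast_mul_cpow_neg, natCast_mul_cpow_neg, ← Complex.cpow_add _ _ hb, mul_comm]
      ring_nf
  rw [hz, (hasSum_natCast_cpow_neg hs).tsum_eq, (hasSum_natCast_cpow_neg hs2).tsum_eq] at hmul
  rw [← hmul, mul_div_cancel_right₀ _ (riemannZeta_ne_zero_of_one_lt_re hs2)]
  exact hqs.hasSum

open Classical in
theorem hasSum_odd_squarefree_cpow_neg (hs : 1 < s.re) :
    ∃ A : ℂ, HasSum (fun n : ℕ => if Squarefree n ∧ Odd n then (n : ℂ) ^ (-s) else 0) A ∧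
      HasSum (fun n : ℕ => if Squarefree n ∧ Even n then (n : ℂ) ^ (-s) else 0)
        ((2 : ℂ) ^ (-s) * A) ∧
      (1 + (2 : ℂ) ^ (-s)) * A = riemannZeta s / riemannZeta (2 * s) := by
  have hos : Summable (fun n : ℕ => if Squarefree n ∧ Odd n then (n : ℂ) ^ (-s) else 0) :=
    Summable.of_norm_bounded (summable_natCast_cpow_neg hs).norm fun n => by
      split_ifs <;> simp
  have hA := hos.hasSum
  set A := ∑' n : ℕ, if Squarefree n ∧ Odd n then (n : ℂ) ^ (-s) else 0
  have hE : HasSum (fun n : ℕ => if Squarefree n ∧ Even n then (n : ℂ) ^ (-s) else 0)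
      ((2 : ℂ) ^ (-s) * A) := by
    rw [← (mul_right_injective₀ (two_ne_zero (α := ℕ))).hasSum_iff]
    · refine (hA.mul_left ((2 : ℂ) ^ (-s))).congr_fun ?_
      intro n
      have : Squarefree (2 * n) ∧ Even (2 * n) ↔ Squarefree n ∧ Odd n := by
        rw [Nat.squarefree_mul_iff, Nat.coprime_two_left]
        have := Nat.prime_two.squarefree
        simp
        tauto
      simp only [Function.comp, this, natCast_mul_cpow_neg]
      split_ifs <;> simp
    · intro n hn
      rw [if_neg]
      rintro ⟨-, k, rfl⟩
      exact hn ⟨k, by ring⟩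
  refine ⟨A, hA, hE, ?_⟩
  refine HasSum.unique ?_ (hasSum_squarefree_cpow_neg hs)
  rw [add_mul, one_mul]
  refine (hA.add hE).congr_fun fun n => ?_
  by_cases h : Squarefree n <;> rcases Nat.even_or_odd n with h' | h' <;>
    simp [h, h', Nat.not_odd_iff_even.2, Nat.not_even_iff_odd.2]

theorem fundDisc_cpow (d : ℤ) : ((|fundDisc d| : ℤ) : ℂ) ^ (-s) =
    (if d % 4 = 1 then 1 else (4 : ℂ) ^ (-s)) * (d.natAbs : ℂ) ^ (-s) := by
  unfold fundDisc
  rw [Int.abs_eq_natAbs]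
  split_ifs
  · simp
  · rw [Int.natAbs_mul]
    exact natCast_mul_cpow_neg 4 d.natAbs

open Classical in
theorem hasSum_fundDisc_cpow (hs : 1 < s.re) :
    HasSum (fun d : ℤ => if Squarefree d then ((|fundDisc d| : ℤ) : ℂ) ^ (-s) else 0)
      ((1 - (2 : ℂ) ^ (-s) + 2 * (4 : ℂ) ^ (-s)) * riemannZeta s / riemannZeta (2 * s)) := by
  set g : ℤ → ℂ := fun d => if Squarefree d then ((|fundDisc d| : ℤ) : ℂ) ^ (-s) else 0 with hg
  have hbound : ∀ d : ℤ, ‖g d‖ ≤ (1 + ‖(4 : ℂ) ^ (-s)‖) * ‖(d.natAbs : ℂ) ^ (-s)‖ := by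
    intro d
    simp only [hg, fundDisc_cpow]
    split_ifs
    · rw [norm_mul]
      gcongr
      simp
    · rw [norm_mul]
      gcongr
      linarith
    · rw [norm_zero]
      positivity
  have hsum := (summable_natCast_cpow_neg hs).norm.mul_left (1 + ‖(4 : ℂ) ^ (-s)‖)
  have h1 : Summable fun n : ℕ => g n := Summable.of_norm_bounded hsum fun n => hbound n
  have h2 : Summable fun n : ℕ => g (-n) := Summable.of_norm_bounded hsum fun n => by
    simpa using hbound (-n)
  obtain ⟨A, hA, hE, hAQ⟩ := hasSum_odd_squarefree_cpow_neg hs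
  have h3 : HasSum (fun n : ℕ => g n + g (-n))
      ((1 + (4 : ℂ) ^ (-s)) * A + 2 * (4 : ℂ) ^ (-s) * ((2 : ℂ) ^ (-s) * A)) := by
    refine ((hA.mul_left _).add (hE.mul_left _)).congr_fun fun n => ?_
    have hneg : Squarefree (-(n : ℤ)) ↔ Squarefree n := by
      rw [← Int.squarefree_natAbs, Int.natAbs_neg, Int.natAbs_natCast]
    simp only [hg, fundDisc_cpow, Int.natAbs_neg, Int.natAbs_natCast, hneg,
      Int.squarefree_natCast]
    by_cases h : Squarefree n
    · have h4 : ¬ (4 : ℤ) ∣ n := four_not_dvd_of_squarefree (Int.squarefree_natCast.2 h)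
      rcases Nat.even_or_odd n with h' | h'
      · have e1 : ¬ (n : ℤ) % 4 = 1 := by have := Nat.even_iff.1 h'; omega
        have e2 : ¬ -(n : ℤ) % 4 = 1 := by have := Nat.even_iff.1 h'; omega
        simp [h, h', e1, e2, Nat.not_odd_iff_even.2]
        ring
      · have h5 := Nat.odd_iff.1 h'
        by_cases e1 : (n : ℤ) % 4 = 1
        · have e2 : ¬ -(n : ℤ) % 4 = 1 := by omega
          simp [h, h', e1, e2, Nat.not_even_iff_odd.2]
          ring
        · have e2 : -(n : ℤ) % 4 = 1 := by omega
          simp [h, h', e1, e2, Nat.not_even_iff_odd.2]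
          ring
    · simp [h]
  have h0 : g 0 = 0 := by simp [hg]
  have h4 : (4 : ℂ) ^ (-s) = (2 : ℂ) ^ (-s) * (2 : ℂ) ^ (-s) := by
    simpa using natCast_mul_cpow_neg (s := s) 2 2
  have h5 := h1.hasSum.of_nat_of_neg h2.hasSum
  rw [h0, sub_zero, (h1.hasSum.add h2.hasSum).unique h3] at h5
  have h6 : (1 - (2 : ℂ) ^ (-s) + 2 * (4 : ℂ) ^ (-s)) * riemannZeta s / riemannZeta (2 * s) =
      (1 + (4 : ℂ) ^ (-s)) * A + 2 * (4 : ℂ) ^ (-s) * ((2 : ℂ) ^ (-s) * A) := by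
    rw [mul_div_assoc, ← hAQ, h4]
    ring
  rw [h6]
  exact h5

theorem hasSum_quadParam (hs : 1 < s.re) :
    HasSum (fun d : QuadParam => ((|fundDisc d| : ℤ) : ℂ) ^ (-s))
      (-1 + (1 - (2 : ℂ) ^ (-s) + 2 * (4 : ℂ) ^ (-s)) * riemannZeta s / riemannZeta (2 * s)) := by
  classical
  have h := (hasSum_fundDisc_cpow hs).update 1 0
  have h1 : (if Squarefree (1 : ℤ) then ((|fundDisc 1| : ℤ) : ℂ) ^ (-s) else 0) = 1 := by
    simp [fundDisc]
  rw [h1, zero_sub] at h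
  refine (hasSum_subtype_iff_indicator (s := {d : ℤ | Squarefree d ∧ d ≠ 1})
    (f := fun d : ℤ => ((|fundDisc d| : ℤ) : ℂ) ^ (-s))).2 (h.congr_fun fun d => ?_)
  by_cases hd : d = 1
  · simp [hd]
  · by_cases hd' : Squarefree d <;> simp [hd, hd']

end

/-- The field `ℚ(√d)`, as a quadratic field. -/
def QuadraticField.ofParam (d : QuadParam) : QuadraticField where
  carrier := QSqrt d
  deg := by convert! finrank_qSqrt d

/-- Isomorphism classes of quadratic fields correspond to squarefree integers `d ≠ 1`. -/
noncomputable def quadParamEquiv : QuadParam ≃ Quotient QuadraticField.setoid :=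
  Equiv.ofBijective (fun d => Quotient.mk _ (QuadraticField.ofParam d)) <| by
    refine ⟨fun d d' h => ?_, fun C => ?_⟩
    · obtain ⟨e⟩ := Quotient.exact h
      exact qSqrt_ringEquiv_eq e
    · induction C using Quotient.inductionOn with
      | h K =>
        obtain ⟨d, ⟨e⟩⟩ := exists_qSqrt_ringEquiv K.deg
        exact ⟨d, Quotient.sound ⟨e⟩⟩

theorem discr_out_quadParamEquiv (d : QuadParam) :
    NumberField.discr (Quotient.out (quadParamEquiv d)).carrier = fundDisc d := by
  obtain ⟨e⟩ : Nonempty ((Quotient.out (quadParamEquiv d)).carrier ≃+* QSqrt d) :=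
    Quotient.exact (Quotient.out_eq (quadParamEquiv d))
  rw [← discr_qSqrt d]
  exact NumberField.discr_eq_discr_of_ringEquiv _ e

/-- The Dirichlet series of quadratic field discriminants: for `Re(s) > 1`,
`∑_{[K:ℚ]=2} |Disc(K)|^{-s} = -1 + (1 - 2^{-s} + 2·4^{-s}) ζ(s)/ζ(2s)`,
the sum ranging over isomorphism classes of quadratic fields. -/
theorem quadratic_dirichlet_series :
    ∀ s : ℂ, 1 < s.re →
      HasSum (fun C : Quotient QuadraticField.setoid =>
          ((|NumberField.discr (Quotient.out C).carrier| : ℤ) : ℂ) ^ (-s))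
        (-1 + (1 - (2 : ℂ) ^ (-s) + 2 * (4 : ℂ) ^ (-s)) * riemannZeta s / riemannZeta (2 * s)) := by
  intro s hs
  rw [← quadParamEquiv.hasSum_iff]
  refine (hasSum_quadParam hs).congr_fun fun d => ?_
  simp only [Function.comp_apply, discr_out_quadParamEquiv]
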